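/- Let Q be a rack, A a commutative ring, and m ⊆ A an ideal. Let f: AQ² → AQ² be an A-linear map with all matrix entries in m such that d f = 0 and f is equivariant under the diagonal Inn(Q)-action, i.e. f^{u^α,w^α}_{x^α,z^α} = f^{u,w}_{x,z} for all u,w,x,z ∈ Q and all α ∈ Inn(Q). Then there exists an A-linear map g: AQ → AQ with entries in m such that f − d g is entropic. -/

import Mathlib

open TensorProduct

noncomputable section

/-- A rack: a set with a binary operation `act x y = x ^ y` such that all right
translations are bijective and the operation is right self-distributive. -/
structure YBRack (Q : Type*) where
  act : Q → Q → Q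
  act_bijective : ∀ y : Q, Function.Bijective fun x => act x y
  self_distrib : ∀ x y z : Q, act (act x y) z = act (act x z) (act y z)

namespace YBRack

variable {Q : Type*} {A : Type*} [CommRing A]

/-- Right translation by `y` as a permutation of `Q`. -/
def rho (R : YBRack Q) (y : Q) : Equiv.Perm Q :=
  Equiv.ofBijective _ (R.act_bijective y)

/-- The inner automorphism group of a rack: the subgroup of `Perm Q` generated
by all right translations. -/
def Inn (R : YBRack Q) : Subgroup (Equiv.Perm Q) :=
  Subgroup.closure (Set.range R.rho)

/-- Behavioural equivalence: `x ≡ y` iff `ϱ(x) = ϱ(y)`. -/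
def BEquiv (R : YBRack Q) (x y : Q) : Prop := R.rho x = R.rho y

end YBRack
namespace YBRack

variable {Q : Type*} {A : Type*} [CommRing A]

open scoped Classical in
/-- The explicit coboundary of a 2-cochain (matrix on `Q × Q`). -/
def dTwo (R : YBRack Q) (f : Q × Q → Q × Q → A) (p q : Q × Q × Q) : A :=
  f (p.2.1, p.2.2) (q.2.1, q.2.2) *
      ((if R.act (R.act p.1 p.2.1) p.2.2 = R.act (R.act q.1 q.2.1) q.2.2 then 1 else 0)
        - (if p.1 = q.1 then 1 else 0))
  - f (p.1, p.2.2) (q.1, q.2.2) * (if R.act p.2.1 p.2.2 = R.act q.2.1 q.2.2 then 1 else 0)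
  + f (R.act p.1 p.2.1, p.2.2) (R.act q.1 q.2.1, q.2.2) * (if p.2.1 = q.2.1 then 1 else 0)
  + (f (p.1, p.2.1) (q.1, q.2.1)
      - f (R.act p.1 p.2.2, R.act p.2.1 p.2.2) (R.act q.1 q.2.2, R.act q.2.1 q.2.2)) *
      (if p.2.2 = q.2.2 then 1 else 0)

open scoped Classical in
/-- The explicit coboundary of a 1-cochain (matrix on `Q`). -/
def dOne (R : YBRack Q) (g : Q → Q → A) (p q : Q × Q) : A :=
  g p.2 q.2 * ((if R.act p.1 p.2 = R.act q.1 q.2 then 1 else 0) - (if p.1 = q.1 then 1 else 0))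
  - (g p.1 q.1 - g (R.act p.1 p.2) (R.act q.1 q.2)) * (if p.2 = q.2 then 1 else 0)

/-- Entropic matrix on `Q × Q`: quasi-diagonal and fully equivariant. -/
def EntropicMat2 (R : YBRack Q) (f : Q × Q → Q × Q → A) : Prop :=
  (∀ u v x y : Q, (¬ R.BEquiv u x ∨ ¬ R.BEquiv v y) → f (u, v) (x, y) = 0) ∧
  (∀ (u v x y : Q) (α β : R.Inn),
    f ((α : Equiv.Perm Q) u, (β : Equiv.Perm Q) v) ((α : Equiv.Perm Q) x, (β : Equiv.Perm Q) y)
      = f (u, v) (x, y))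

end YBRack

namespace YBRack

variable {Q : Type*} {A : Type*} [CommRing A]

lemma act_left_inj (R : YBRack Q) {x y z : Q} : R.act x z = R.act y z ↔ x = y :=
  (R.act_bijective z).1.eq_iff

lemma bEquiv_iff (R : YBRack Q) {x y : Q} : R.BEquiv x y ↔ ∀ u, R.act u x = R.act u y :=
  Equiv.ext_iff

lemma rho_mem_inn (R : YBRack Q) (y : Q) : R.rho y ∈ R.Inn :=
  Subgroup.subset_closure ⟨y, rfl⟩

lemma inn_map_act (R : YBRack Q) (α : R.Inn) (x y : Q) :
    (α : Equiv.Perm Q) (R.act x y) = R.act ((α : Equiv.Perm Q) x) ((α : Equiv.Perm Q) y) := by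
  obtain ⟨α, hα⟩ := α
  change α (R.act x y) = R.act (α x) (α y)
  induction hα using Subgroup.closure_induction generalizing x y with
  | mem α h =>
    obtain ⟨z, rfl⟩ := h
    exact R.self_distrib x y z
  | one => rfl
  | mul α β _ _ hα hβ => simp only [Equiv.Perm.mul_apply, hα, hβ]
  | inv α _ hα =>
    apply α.injective
    simp only [hα, Equiv.Perm.inv_def, Equiv.apply_symm_apply]

lemma bEquiv_inn_iff (R : YBRack Q) (α : R.Inn) {x y : Q} :
    R.BEquiv ((α : Equiv.Perm Q) x) ((α : Equiv.Perm Q) y) ↔ R.BEquiv x y := by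
  simp only [bEquiv_iff]
  rw [← (α : Equiv.Perm Q).forall_congr_right]
  simp only [← inn_map_act, EmbeddingLike.apply_eq_iff_eq]

/-- Two elements are behaviourally inequivalent iff their right translations send some pair of
distinct elements to the same element. -/
lemma not_bEquiv_iff (R : YBRack Q) {w z : Q} :
    ¬ R.BEquiv w z ↔ ∃ p : Q × Q, p.1 ≠ p.2 ∧ R.act p.1 w = R.act p.2 z := by
  rw [bEquiv_iff]
  constructor
  · intro h
    obtain ⟨y, hy⟩ := not_forall.1 h
    obtain ⟨v, hv⟩ := (R.act_bijective w).2 (R.act y z)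
    refine ⟨(v, y), ?_, hv⟩
    intro (hvy : v = y)
    subst hvy
    exact hy hv
  · rintro ⟨⟨v, y⟩, hne, hvy⟩ h
    rw [← h, act_left_inj] at hvy
    exact hne hvy

/-- Equivariance of a matrix on `Q × Q` under the diagonal action of `Inn(Q)`. -/
def DiagEquivariant (R : YBRack Q) (f : Q × Q → Q × Q → A) : Prop :=
  ∀ (u w x z : Q) (α : R.Inn),
    f ((α : Equiv.Perm Q) u, (α : Equiv.Perm Q) w) ((α : Equiv.Perm Q) x, (α : Equiv.Perm Q) z)
      = f (u, w) (x, z)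

open scoped Classical in
/-- For a diagonally equivariant matrix the last summand of the coboundary vanishes. -/
lemma DiagEquivariant.cocycle {R : YBRack Q} {f : Q × Q → Q × Q → A} (heqv : R.DiagEquivariant f)
    (hcoc : ∀ p q, R.dTwo f p q = 0) (u v w x y z : Q) :
    f (v, w) (y, z) *
        ((if R.act (R.act u v) w = R.act (R.act x y) z then 1 else 0) - (if u = x then 1 else 0))
      - f (u, w) (x, z) * (if R.act v w = R.act y z then 1 else 0)
      + f (R.act u v, w) (R.act x y, z) * (if v = y then 1 else 0) = 0 := by
  have h := hcoc (u, v, w) (x, y, z)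
  have h0 : (f (u, v) (x, y) - f (R.act u w, R.act v w) (R.act x z, R.act y z)) *
      (if w = z then 1 else 0) = 0 := by
    split_ifs with hw
    · subst hw
      rw [mul_one, sub_eq_zero]
      exact (heqv u v x y ⟨R.rho w, R.rho_mem_inn w⟩).symm
    · exact mul_zero _
  simp only [dTwo] at h
  rwa [h0, add_zero] at h

open scoped Classical in
lemma DiagEquivariant.eq_mul_of_act_eq {R : YBRack Q} {f : Q × Q → Q × Q → A}
    (heqv : R.DiagEquivariant f) (hcoc : ∀ p q, R.dTwo f p q = 0) {v w y z : Q} (hne : v ≠ y)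
    (hvy : R.act v w = R.act y z) (u x : Q) :
    f (u, w) (x, z) = f (v, w) (y, z) *
      ((if R.act u w = R.act x z then 1 else 0) - (if u = x then 1 else 0)) := by
  have h := heqv.cocycle hcoc u v w x y z
  rw [R.self_distrib u v w, R.self_distrib x y z, hvy] at h
  simp only [act_left_inj, hne, if_true, if_false, mul_one, mul_zero, add_zero] at h
  exact (sub_eq_zero.1 h).symm

lemma DiagEquivariant.eq_zero_of_not_bEquiv {R : YBRack Q} {f : Q × Q → Q × Q → A}
    (heqv : R.DiagEquivariant f) (hcoc : ∀ p q, R.dTwo f p q = 0) {v w y z : Q}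
    (hwz : R.BEquiv w z) (hvy : ¬ R.BEquiv v y) : f (v, w) (y, z) = 0 := by
  have hne : v ≠ y := by
    rintro rfl
    exact hvy rfl
  obtain ⟨u, hu⟩ := not_forall.1 (mt R.bEquiv_iff.2 hvy)
  have h := heqv.cocycle hcoc u v w u y z
  simpa [← R.bEquiv_iff.1 hwz, act_left_inj, hne, hu] using h

lemma DiagEquivariant.inn_fst {R : YBRack Q} {f : Q × Q → Q × Q → A}
    (heqv : R.DiagEquivariant f) (hcoc : ∀ p q, R.dTwo f p q = 0) {w z : Q}
    (hwz : R.BEquiv w z) (α : R.Inn) (u x : Q) :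
    f ((α : Equiv.Perm Q) u, w) ((α : Equiv.Perm Q) x, z) = f (u, w) (x, z) := by
  classical
  obtain ⟨α, hα⟩ := α
  change f (α u, w) (α x, z) = f (u, w) (x, z)
  induction hα using Subgroup.closure_induction generalizing u x with
  | mem α h =>
    obtain ⟨v, rfl⟩ := h
    have h := heqv.cocycle hcoc u v w x v z
    simp only [← R.bEquiv_iff.1 hwz, act_left_inj, sub_self, mul_zero, if_true, mul_one,
      zero_sub] at h
    exact (neg_add_eq_zero.1 h).symm
  | one => rfl
  | mul α β _ _ hα hβ => simp only [Equiv.Perm.mul_apply, hα, hβ]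
  | inv α _ hα => rw [← hα, Equiv.Perm.inv_def, Equiv.apply_symm_apply, Equiv.apply_symm_apply]

open scoped Classical in
/-- The 1-cochain whose coboundary is the part of `f` on pairs with behaviourally inequivalent
second entries. -/
def primitive (R : YBRack Q) (f : Q × Q → Q × Q → A) (w z : Q) : A :=
  if h : ∃ p : Q × Q, p.1 ≠ p.2 ∧ R.act p.1 w = R.act p.2 z then
    f (h.choose.1, w) (h.choose.2, z)
  else 0

lemma primitive_mem {R : YBRack Q} {f : Q × Q → Q × Q → A} {m : Ideal A}
    (hfm : ∀ p q, f p q ∈ m) (w z : Q) : R.primitive f w z ∈ m := by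
  unfold primitive
  split_ifs
  exacts [hfm _ _, m.zero_mem]

lemma primitive_of_bEquiv {R : YBRack Q} (f : Q × Q → Q × Q → A) {w z : Q}
    (h : R.BEquiv w z) : R.primitive f w z = 0 :=
  dif_neg fun hp => R.not_bEquiv_iff.2 hp h

lemma DiagEquivariant.primitive_eq {R : YBRack Q} {f : Q × Q → Q × Q → A}
    (heqv : R.DiagEquivariant f) (hcoc : ∀ p q, R.dTwo f p q = 0) {v w y z : Q} (hne : v ≠ y)
    (hvy : R.act v w = R.act y z) : R.primitive f w z = f (v, w) (y, z) := by
  have h : ∃ p : Q × Q, p.1 ≠ p.2 ∧ R.act p.1 w = R.act p.2 z := ⟨(v, y), hne, hvy⟩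
  rw [primitive, dif_pos h, heqv.eq_mul_of_act_eq hcoc h.choose_spec.1 h.choose_spec.2 v y,
    if_pos hvy, if_neg hne, sub_zero, mul_one]

lemma DiagEquivariant.primitive_inn {R : YBRack Q} {f : Q × Q → Q × Q → A}
    (heqv : R.DiagEquivariant f) (hcoc : ∀ p q, R.dTwo f p q = 0) (α : R.Inn) (w z : Q) :
    R.primitive f ((α : Equiv.Perm Q) w) ((α : Equiv.Perm Q) z) = R.primitive f w z := by
  by_cases h : R.BEquiv w z
  · rw [primitive_of_bEquiv f h, primitive_of_bEquiv f ((R.bEquiv_inn_iff α).2 h)]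
  · obtain ⟨⟨v, y⟩, hne, hvy⟩ := R.not_bEquiv_iff.1 h
    rw [heqv.primitive_eq hcoc hne hvy, ← heqv v w y z α]
    refine heqv.primitive_eq hcoc ((α : Equiv.Perm Q).injective.ne hne) ?_
    rw [← inn_map_act, ← inn_map_act, hvy]

open scoped Classical in
lemma DiagEquivariant.sub_dOne_primitive {R : YBRack Q} {f : Q × Q → Q × Q → A}
    (heqv : R.DiagEquivariant f) (hcoc : ∀ p q, R.dTwo f p q = 0) (u w x z : Q) :
    f (u, w) (x, z) - R.dOne (R.primitive f) (u, w) (x, z) =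
      if R.BEquiv w z then f (u, w) (x, z) else 0 := by
  have h0 : (R.primitive f u x - R.primitive f (R.act u w) (R.act x z)) *
      (if w = z then 1 else 0) = 0 := by
    split_ifs with hw
    · subst hw
      rw [mul_one, sub_eq_zero]
      exact (heqv.primitive_inn hcoc ⟨R.rho w, R.rho_mem_inn w⟩ u x).symm
    · exact mul_zero _
  simp only [dOne, h0, sub_zero]
  by_cases h : R.BEquiv w z
  · rw [if_pos h, primitive_of_bEquiv f h, zero_mul, sub_zero]
  · obtain ⟨⟨v, y⟩, hne, hvy⟩ := R.not_bEquiv_iff.1 h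
    rw [if_neg h, heqv.primitive_eq hcoc hne hvy, heqv.eq_mul_of_act_eq hcoc hne hvy u x, sub_self]

end YBRack

/-- (Lemma: every equivariant 2-cocycle is cohomologous to an
entropic one.) If `f` is a 2-cocycle with entries in `m` that is equivariant under
the diagonal action of `Inn(Q)`, then there is a 1-cochain `g` with entries in `m`
such that `f - d g` is entropic. -/
theorem equivariant_cocycle_cohomologous_entropic
    {A Q : Type*} [CommRing A] (R : YBRack Q) (m : Ideal A)
    (f : Q × Q → Q × Q → A) (hfm : ∀ p q, f p q ∈ m)
    (hcoc : ∀ p q, R.dTwo f p q = 0)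
    (heqv : ∀ (u w x z : Q) (α : R.Inn),
      f ((α : Equiv.Perm Q) u, (α : Equiv.Perm Q) w) ((α : Equiv.Perm Q) x, (α : Equiv.Perm Q) z)
        = f (u, w) (x, z)) :
    ∃ g : Q → Q → A, (∀ x u, g x u ∈ m) ∧
      R.EntropicMat2 (fun p q => f p q - R.dOne g p q) := by
  classical
  have heqv' : R.DiagEquivariant f := heqv
  refine ⟨R.primitive f, YBRack.primitive_mem hfm, ?_, ?_⟩
  · intro u v x y h
    simp only [heqv'.sub_dOne_primitive hcoc]
    split_ifs with hvy
    · exact heqv'.eq_zero_of_not_bEquiv hcoc hvy (h.resolve_right (not_not_intro hvy))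
    · rfl
  · intro u v x y α β
    simp only [heqv'.sub_dOne_primitive hcoc, R.bEquiv_inn_iff]
    split_ifs with hvy
    · rw [heqv'.inn_fst hcoc ((R.bEquiv_inn_iff β).2 hvy) α,
        ← heqv'.inn_fst hcoc ((R.bEquiv_inn_iff β).2 hvy) β, heqv]
    · rfl

end
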